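/- Let n+s be odd with 0 ≤ s ≤ n−5 and f ∈ WRP with sign ε and dual g, and consider the code C_{D_{f,nsq}} with defining set D_{f,nsq} = {x ∈ F_q : f(x) ∈ NSQ}. If ε η_0(−1)^{(n+s−1)/2} = 1, then C_{D_{f,nsq}} is a minimal linear code with parameters [((p−1)/2)(p^{n−1} − p^{(n+s−1)/2}), n, ((p−1)/2)((p−1)p^{n−2} − (p+1)p^{(n+s−3)/2})]_p; otherwise C_{D_{f,nsq}} is a minimal linear code with parameters [((p−1)/2)(p^{n−1} + p^{(n+s−1)/2}), n, ((p−1)²/2)p^{n−2}]_p. -/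

import Mathlib

open scoped BigOperators Classical

noncomputable section

/-- `ξ_p^j` for `j : ZMod p`, where `ξ_p = exp(2πi/p)` and the exponent `j`
is lifted to a natural number. -/
def ep (p : ℕ) (j : ZMod p) : ℂ :=
  Complex.exp (2 * Real.pi * Complex.I * (j.val : ℂ) / (p : ℂ))

/-- `√(p*)`: equal to `√p` if `p ≡ 1 (mod 4)` and to `i√p` if `p ≡ 3 (mod 4)`. -/
def sqrtPStar (p : ℕ) : ℂ :=
  if p % 4 = 1 then ((Real.sqrt p : ℝ) : ℂ) else Complex.I * ((Real.sqrt p : ℝ) : ℂ)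

/-- The quadratic character `η₀` of `F_p` (extended by `η₀(0) = 0`), with values in `ℂ`. -/
def eta0 (p : ℕ) [Fact p.Prime] (j : ZMod p) : ℂ :=
  ((quadraticChar (ZMod p) j : ℤ) : ℂ)

/-- The Walsh transform of `f : F_q → F_p`. -/
def walsh (p : ℕ) {F : Type*} [Field F] [Fintype F] [Algebra (ZMod p) F]
    (f : F → ZMod p) (β : F) : ℂ :=
  ∑ x : F, ep p (f x - Algebra.trace (ZMod p) F (β * x))

/-- `f` is weakly regular `s`-plateaued with sign `ε` and dual `g`:
`W_f(β) = ε √(p*)^{n+s} ξ_p^{g(β)}` on the Walsh support, `W_f(β) = 0` off it,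
and `g` vanishes off the Walsh support. -/
def IsWeaklyRegularPlateaued (p n s : ℕ) {F : Type*} [Field F] [Fintype F]
    [Algebra (ZMod p) F] (f : F → ZMod p) (ε : ℂ) (g : F → ZMod p) : Prop :=
  (ε = 1 ∨ ε = -1) ∧
  (∀ β : F, walsh p f β ≠ 0 →
      walsh p f β = ε * sqrtPStar p ^ (n + s) * ep p (g β)) ∧
  (∀ β : F, walsh p f β = 0 → g β = 0)

/-- `f` lies in the class `WRP`: weakly regular `s`-plateaued with sign `ε` and dual `g`,
unbalanced, `f(0) = 0`, and `f(ax) = a^h f(x)` for some positive even `h` with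
`gcd(h-1, p-1) = 1`. -/
def IsWRP (p n s : ℕ) {F : Type*} [Field F] [Fintype F]
    [Algebra (ZMod p) F] (f : F → ZMod p) (ε : ℂ) (g : F → ZMod p) : Prop :=
  IsWeaklyRegularPlateaued p n s f ε g ∧
  walsh p f 0 ≠ 0 ∧
  f 0 = 0 ∧
  ∃ h : ℕ, 0 < h ∧ Even h ∧ Nat.gcd (h - 1) (p - 1) = 1 ∧
    ∀ (a : (ZMod p)ˣ) (x : F),
      f (algebraMap (ZMod p) F (a : ZMod p) * x) = (a : ZMod p) ^ h * f x

/-- The defining set `D_f = {x ∈ F_q^* : f(x) = 0}`. -/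
def Dzero (p : ℕ) {F : Type*} [Field F] [Fintype F] [Algebra (ZMod p) F]
    (f : F → ZMod p) : Finset F :=
  Finset.univ.filter fun x => x ≠ 0 ∧ f x = 0

/-- The defining set `D_{f,sq} = {x ∈ F_q : f(x) ∈ SQ}`. -/
def Dsq (p : ℕ) {F : Type*} [Field F] [Fintype F] [Algebra (ZMod p) F]
    (f : F → ZMod p) : Finset F :=
  Finset.univ.filter fun x => f x ≠ 0 ∧ IsSquare (f x)

/-- The defining set `D_{f,nsq} = {x ∈ F_q : f(x) ∈ NSQ}`. -/
def Dnsq (p : ℕ) {F : Type*} [Field F] [Fintype F] [Algebra (ZMod p) F]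
    (f : F → ZMod p) : Finset F :=
  Finset.univ.filter fun x => f x ≠ 0 ∧ ¬ IsSquare (f x)

/-- The codeword `c_β = (Tr(βd))_{d ∈ D}` of the code `C_D`. -/
def cword (p : ℕ) {F : Type*} [Field F] [Fintype F] [Algebra (ZMod p) F]
    (D : Finset F) (β : F) : D → ZMod p :=
  fun d => Algebra.trace (ZMod p) F (β * (d : F))

/-- The Hamming weight of the codeword `c_β` of the code `C_D`. -/
def wtOn (p : ℕ) {F : Type*} [Field F] [Fintype F] [Algebra (ZMod p) F]
    (D : Finset F) (β : F) : ℕ :=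
  (D.filter fun d => Algebra.trace (ZMod p) F (β * d) ≠ 0).card

/-- `u` covers `v` : the support of `v` is contained in the support of `u`. -/
def Covers {k : ℕ} {ι : Type*} (u v : ι → ZMod k) : Prop :=
  ∀ i, v i ≠ 0 → u i ≠ 0

/-- The code `C_D` is minimal: every nonzero codeword covers only its own
nonzero scalar multiples among the nonzero codewords. -/
def IsMinimalCode (p : ℕ) {F : Type*} [Field F] [Fintype F] [Algebra (ZMod p) F]
    (D : Finset F) : Prop :=
  ∀ β : F, cword p D β ≠ 0 →
    ∀ β' : F, cword p D β' ≠ 0 → Covers (cword p D β) (cword p D β') →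
      ∃ a : ZMod p, a ≠ 0 ∧ cword p D β' = a • cword p D β

/-- The code `C_D` is an `[m, n, d]_p` code: length `m`, dimension `n`
(i.e. `β ↦ c_β` is injective, so the code has `p^n` codewords), and minimum
nonzero Hamming weight `d`. -/
def HasParams (p : ℕ) {F : Type*} [Field F] [Fintype F] [Algebra (ZMod p) F]
    (D : Finset F) (m d : ℤ) : Prop :=
  (D.card : ℤ) = m ∧
  Function.Injective (cword p D) ∧
  (∀ β : F, cword p D β ≠ 0 → d ≤ (wtOn p D β : ℤ)) ∧
  (∃ β : F, cword p D β ≠ 0 ∧ (wtOn p D β : ℤ) = d)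

open Polynomial Finset

section

/-- The Euler operator `P ↦ X * P'` on polynomials. -/
def eulerOp (R : Type*) [CommRing R] : Module.End R R[X] :=
  LinearMap.mulLeft R X ∘ₗ derivative

lemma eulerOp_apply {R : Type*} [CommRing R] (P : R[X]) :
    eulerOp R P = X * derivative P := rfl

lemma eulerOp_pow_X_pow {R : Type*} [CommRing R] (k j : ℕ) :
    (eulerOp R ^ k) (X ^ j) = C ((j : R) ^ k) * X ^ j := by
  induction k with
  | zero => simp
  | succ k ih =>
    rw [pow_succ', Module.End.mul_apply, ih, eulerOp_apply, derivative_C_mul_X_pow]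
    rcases j with _ | j
    · simp
    · simp only [Nat.add_sub_cancel, pow_succ, C_mul]
      ring

lemma eval_one_eulerOp_pow {R : Type*} [CommRing R] (k : ℕ) (Q : R[X]) :
    eval 1 ((eulerOp R ^ k) ((X - 1) ^ k * Q)) = (k.factorial : R) * eval 1 Q := by
  induction k generalizing Q with
  | zero => simp
  | succ k ih =>
    have h : eulerOp R ((X - 1) ^ (k + 1) * Q) =
        (X - 1) ^ k * ((k + 1 : R[X]) * X * Q + X * (X - 1) * derivative Q) := by
      simp only [eulerOp_apply, derivative_mul, derivative_pow_succ, derivative_sub,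
        derivative_X, derivative_one, sub_zero, mul_one, C_add, map_natCast, C_1]
      ring
    rw [pow_succ, Module.End.mul_apply, h, ih]
    simp [Nat.factorial_succ]
    ring

lemma prod_two_mul_odd_mul_factorial (m : ℕ) :
    (∏ k ∈ range m, 2 * (2 * k + 1)) * m.factorial = (2 * m).factorial := by
  induction m with
  | zero => simp
  | succ m ih =>
    rw [prod_range_succ, show 2 * (m + 1) = 2 * m + 1 + 1 by ring, Nat.factorial_succ (2 * m + 1),
      Nat.factorial_succ (2 * m), ← ih, Nat.factorial_succ]
    ring

lemma ep_eq_stdAddChar (p : ℕ) [NeZero p] (j : ZMod p) : ep p j = ZMod.stdAddChar j := by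
  rw [ZMod.stdAddChar_apply, ZMod.toCircle_apply, ep]

lemma ep_natCast (p : ℕ) [NeZero p] (k : ℕ) : ep p (k : ZMod p) = ep p 1 ^ k := by
  rw [ep_eq_stdAddChar, ep_eq_stdAddChar, ← AddChar.map_nsmul_eq_pow, nsmul_one]

lemma isPrimitiveRoot_ep_one (p : ℕ) [Fact p.Prime] : IsPrimitiveRoot (ep p 1) p := by
  have h := Complex.isPrimitiveRoot_exp p (NeZero.ne p)
  convert h using 1
  rw [ep, ZMod.val_one, Nat.cast_one, mul_one]

/-- Half of the factors `ζ ^ a - ζ ^ (-a)`, those with `a` odd. -/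
def oddProd (p m : ℕ) : ℂ := ∏ k ∈ range m, (ep p 1 ^ (2 * k + 1) - ep p 1 ^ (p - (2 * k + 1)))

lemma oddProd_sq {p m : ℕ} [Fact p.Prime] (hm : p = 2 * m + 1) :
    oddProd p m ^ 2 = (-1) ^ m * p := by
  have hζ := isPrimitiveRoot_ep_one p
  set ζ := ep p 1 with hζdef
  have hζ2 : IsPrimitiveRoot (ζ ^ 2) p :=
    hζ.pow_of_coprime 2 (by rw [hm]; simp)
  have h1 : ∏ k ∈ range (2 * m), (1 - (ζ ^ 2) ^ (k + 1)) = (p : ℂ) := by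
    have hm' : p = (2 * m) + 1 := hm
    have := IsPrimitiveRoot.prod_one_sub_pow_eq_order (μ := ζ ^ 2) (n := 2 * m) (by rw [← hm']; exact hζ2)
    rw [this, hm]; push_cast; ring
  have h2 : ∀ (F : ℕ → ℂ) (m : ℕ), ∏ k ∈ range (2 * m), F (k + 1) =
      (∏ k ∈ range m, F (2 * k + 1)) * ∏ k ∈ range m, F (2 * k + 2) := by
    intro F m
    induction m with
    | zero => simp
    | succ m ih =>
      rw [show 2 * (m + 1) = 2 * m + 1 + 1 by ring, prod_range_succ, prod_range_succ, ih,
        prod_range_succ, prod_range_succ]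
      ring
  rw [h2 (fun k => 1 - (ζ ^ 2) ^ k), ← prod_range_reflect (fun k => 1 - (ζ ^ 2) ^ (2 * k + 2)),
    ← prod_mul_distrib] at h1
  rw [oddProd, ← prod_pow, ← h1, ← card_range m, ← prod_const, card_range, ← prod_mul_distrib]
  refine prod_congr rfl fun k hk => ?_
  have hk := mem_range.mp hk
  rw [show 2 * (m - 1 - k) + 2 = p - (2 * k + 1) by omega]
  have h3 : ζ ^ (2 * k + 1) * ζ ^ (p - (2 * k + 1)) = 1 := by
    rw [← pow_add, show 2 * k + 1 + (p - (2 * k + 1)) = p by omega, hζ.pow_eq_one]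
  rw [← hζdef, pow_right_comm ζ 2, pow_right_comm ζ 2]
  generalize ζ ^ (2 * k + 1) = a at h3 ⊢
  generalize ζ ^ (p - (2 * k + 1)) = b at h3 ⊢
  linear_combination (a * b - 1) * h3

/-- The quadratic Gauss sum with respect to `ep`. -/
def quadGaussSum (p : ℕ) [Fact p.Prime] : ℂ := ∑ j : ZMod p, eta0 p j * ep p j

lemma ringChar_zmod_ne_two {p : ℕ} [Fact p.Prime] (hp : p ≠ 2) : ringChar (ZMod p) ≠ 2 := by
  rwa [ZMod.ringChar_zmod_n]

lemma eta0_neg_one {p m : ℕ} [Fact p.Prime] (hp : p ≠ 2) (hm : p = 2 * m + 1) :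
    eta0 p (-1) = (-1) ^ m := by
  have h := quadraticChar_neg_one (ringChar_zmod_ne_two hp)
  rw [ZMod.card, ZMod.χ₄_eq_neg_one_pow (by omega), show p / 2 = m by omega] at h
  simp [eta0, h]

lemma quadGaussSum_sq {p m : ℕ} [Fact p.Prime] (hp : p ≠ 2) (hm : p = 2 * m + 1) :
    quadGaussSum p ^ 2 = (-1) ^ m * p := by
  have hc := ringChar_zmod_ne_two hp
  have h := gaussSum_sq (χ := (quadraticChar (ZMod p)).ringHomComp (Int.castRingHom ℂ))
    (ψ := (ZMod.stdAddChar : AddChar (ZMod p) ℂ))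
    ((MulChar.ringHomComp_ne_one_iff (RingHom.injective_int _)).mpr (quadraticChar_ne_one hc))
    ((quadraticChar_isQuadratic (ZMod p)).comp _) (ZMod.isPrimitive_stdAddChar p)
  have h1 : gaussSum ((quadraticChar (ZMod p)).ringHomComp (Int.castRingHom ℂ))
      (ZMod.stdAddChar : AddChar (ZMod p) ℂ) = quadGaussSum p := by
    simp [gaussSum, quadGaussSum, eta0, ep_eq_stdAddChar]
  rw [h1] at h
  rw [h, ZMod.card]
  congr 1
  simpa [eta0] using eta0_neg_one hp hm

lemma sum_zmod_eq_sum_range {M : Type*} [AddCommMonoid M] (p : ℕ) [NeZero p] (F : ZMod p → M) :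
    ∑ j : ZMod p, F j = ∑ k ∈ range p, F (k : ZMod p) := by
  refine (sum_nbij' (fun k : ℕ => (k : ZMod p)) (fun j => j.val) ?_ ?_ ?_ ?_ ?_).symm
  · simp
  · intro j _; exact mem_range.mpr (ZMod.val_lt j)
  · intro k hk; exact ZMod.val_cast_of_lt (mem_range.mp hk)
  · intro j _; simp
  · simp

/-- A polynomial over `ℤ` vanishing at `ξ_p` is, modulo `p`, divisible by `(X - 1) ^ (p - 1)`. -/
lemma X_sub_one_pow_dvd_map {p : ℕ} [Fact p.Prime] {P : ℤ[X]} (hP : aeval (ep p 1) P = 0) :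
    (X - 1) ^ (p - 1) ∣ P.map (Int.castRingHom (ZMod p)) := by
  have hζ := isPrimitiveRoot_ep_one p
  have h1 : cyclotomic p ℤ ∣ P := by
    rw [cyclotomic_eq_minpoly hζ (NeZero.pos p)]
    exact minpoly.isIntegrallyClosed_dvd (hζ.isIntegral (NeZero.pos p)) hP
  have h2 := Polynomial.map_dvd (Int.castRingHom (ZMod p)) h1
  rw [map_cyclotomic] at h2
  have h3 := cyclotomic_mul_prime_eq_pow_of_not_dvd (ZMod p) (p := p) (n := 1)
    (Nat.Prime.one_lt Fact.out |> Nat.not_dvd_of_pos_of_lt one_pos)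
  rw [one_mul, cyclotomic_one] at h3
  rwa [h3] at h2

lemma natCast_factorial_eq_neg_one {p m : ℕ} [Fact p.Prime] (hm : p = 2 * m + 1) :
    (((2 * m).factorial : ℕ) : ZMod p) = -1 := by
  rw [show 2 * m = p - 1 by omega, ZMod.wilsons_lemma]

lemma eval_one_eulerOp_gaussPoly {p m : ℕ} [Fact p.Prime] (hp : p ≠ 2) (hm : p = 2 * m + 1) :
    eval 1 ((eulerOp (ZMod p) ^ m)
      (∑ k ∈ range p, C ((quadraticChar (ZMod p) k : ℤ) : ZMod p) * X ^ k)) = -1 := by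
  have hm0 : m ≠ 0 := by rintro rfl; exact (Fact.out : p.Prime).one_lt.ne' hm
  simp_rw [map_sum, ← smul_eq_C_mul, map_smul, eulerOp_pow_X_pow, eval_finsetSum]
  simp only [eval_smul, eval_mul, eval_C, eval_pow, eval_X, one_pow, mul_one, smul_eq_mul]
  rw [← sum_zmod_eq_sum_range p (fun j => ((quadraticChar (ZMod p) j : ℤ) : ZMod p) * j ^ m)]
  have h : ∀ j : ZMod p, ((quadraticChar (ZMod p) j : ℤ) : ZMod p) * j ^ m =
      1 - if j = 0 then 1 else 0 := by
    intro j
    rw [quadraticChar_eq_pow_of_char_ne_two' (ringChar_zmod_ne_two hp), ZMod.card, ← pow_add,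
      show p / 2 + m = p - 1 by omega]
    split_ifs with hj
    · rw [hj, zero_pow (by omega), sub_self]
    · rw [ZMod.pow_card_sub_one_eq_one hj, sub_zero]
  simp_rw [h, sum_sub_distrib]
  simp

lemma eval_one_eulerOp_oddProd {p m : ℕ} [Fact p.Prime] (hm : p = 2 * m + 1) :
    eval 1 ((eulerOp (ZMod p) ^ m)
      (∏ k ∈ range m, ((X : (ZMod p)[X]) ^ (2 * k + 1) - X ^ (p - (2 * k + 1))))) = -1 := by
  have h : ∀ a b : ℕ, (X : (ZMod p)[X]) ^ a - X ^ b =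
      (X - 1) * (∑ i ∈ range a, X ^ i - ∑ i ∈ range b, X ^ i) := by
    intro a b
    rw [mul_sub, mul_geom_sum, mul_geom_sum]
    ring
  simp_rw [h, prod_mul_distrib, prod_const, card_range]
  rw [eval_one_eulerOp_pow, eval_prod, ← natCast_factorial_eq_neg_one hm,
    ← prod_two_mul_odd_mul_factorial, mul_comm, Nat.cast_mul, Nat.cast_prod]
  congr 1
  refine prod_congr rfl fun k hk => ?_
  have hk := mem_range.mp hk
  simp only [eval_sub, eval_finsetSum, eval_pow, eval_X, one_pow, sum_const, card_range,
    nsmul_eq_mul, mul_one]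
  rw [Nat.cast_sub (by omega), CharP.cast_eq_zero (ZMod p) p]
  push_cast
  ring

lemma quadGaussSum_eq_oddProd {p m : ℕ} [Fact p.Prime] (hp : p ≠ 2) (hm : p = 2 * m + 1) :
    quadGaussSum p = oddProd p m := by
  have hm0 : m ≠ 0 := by rintro rfl; exact (Fact.out : p.Prime).one_lt.ne' hm
  rcases sq_eq_sq_iff_eq_or_eq_neg.mp ((quadGaussSum_sq hp hm).trans (oddProd_sq hm).symm) with
    h | h
  · exact h
  exfalso
  set A : ℤ[X] := ∑ k ∈ range p, C (quadraticChar (ZMod p) k) * X ^ k with hA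
  set B : ℤ[X] := ∏ k ∈ range m, (X ^ (2 * k + 1) - X ^ (p - (2 * k + 1))) with hB
  have hAζ : aeval (ep p 1) A = quadGaussSum p := by
    rw [quadGaussSum, sum_zmod_eq_sum_range, hA, map_sum]
    refine sum_congr rfl fun k _ => ?_
    simp [eta0, ep_natCast]
  have hBζ : aeval (ep p 1) B = oddProd p m := by
    simp [oddProd, hB]
  obtain ⟨R, hR⟩ := X_sub_one_pow_dvd_map (P := A + B) (p := p)
    (by rw [map_add, hAζ, hBζ, h, neg_add_cancel])
  have h0 := congrArg (fun P => eval 1 ((eulerOp (ZMod p) ^ m) P)) hR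
  simp only [Polynomial.map_add, map_add, eval_add] at h0
  rw [show p - 1 = m + m by omega, pow_add, mul_assoc, eval_one_eulerOp_pow] at h0
  have hA' : A.map (Int.castRingHom (ZMod p)) =
      ∑ k ∈ range p, C ((quadraticChar (ZMod p) k : ℤ) : ZMod p) * X ^ k := by
    simp [hA, Polynomial.map_sum]
  have hB' : B.map (Int.castRingHom (ZMod p)) =
      ∏ k ∈ range m, ((X : (ZMod p)[X]) ^ (2 * k + 1) - X ^ (p - (2 * k + 1))) := by
    simp [hB, Polynomial.map_prod]
  rw [hA', hB', eval_one_eulerOp_gaussPoly hp hm, eval_one_eulerOp_oddProd hm] at h0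
  simp only [eval_mul, eval_pow, eval_sub, eval_X, eval_one, sub_self, zero_pow hm0, zero_mul,
    mul_zero] at h0
  refine Ring.two_ne_zero (ringChar_zmod_ne_two hp) ?_
  linear_combination -h0

lemma oddProd_eq_sin {p m : ℕ} [Fact p.Prime] (hm : p = 2 * m + 1) :
    oddProd p m = Complex.I ^ m *
      ((∏ k ∈ range m, 2 * Real.sin (2 * Real.pi * (2 * k + 1) / p) : ℝ) : ℂ) := by
  have hp0 : (p : ℂ) ≠ 0 := Nat.cast_ne_zero.mpr (NeZero.ne p)
  rw [oddProd]
  push_cast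
  rw [← card_range m, ← prod_const, card_range, ← prod_mul_distrib]
  refine prod_congr rfl fun k hk => ?_
  have hk := mem_range.mp hk
  have hζ := isPrimitiveRoot_ep_one p
  have h1 : ep p 1 ^ (2 * k + 1) = Complex.exp (2 * Real.pi * (2 * k + 1) / p * Complex.I) := by
    rw [ep, ZMod.val_one, ← Complex.exp_nat_mul]
    congr 1
    push_cast
    ring
  have h2 : ep p 1 ^ (p - (2 * k + 1)) =
      Complex.exp (-(2 * Real.pi * (2 * k + 1) / p) * Complex.I) := by
    rw [neg_mul, Complex.exp_neg, ← h1]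
    refine eq_inv_of_mul_eq_one_left ?_
    rw [← pow_add, show p - (2 * k + 1) + (2 * k + 1) = p by omega, hζ.pow_eq_one]
  rw [h1, h2, Complex.sin]
  linear_combination (Complex.exp (2 * Real.pi * (2 * k + 1) / p * Complex.I) -
    Complex.exp (-(2 * Real.pi * (2 * k + 1) / p) * Complex.I)) * Complex.I_sq

lemma sin_pos_of_lt {p k : ℕ} (h : 2 * (2 * k + 1) < p) :
    0 < 2 * Real.sin (2 * Real.pi * (2 * k + 1) / p) := by
  have hp : (0 : ℝ) < p := by exact_mod_cast (by omega : 0 < p)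
  have h' : (2 : ℝ) * (2 * k + 1) < p := by exact_mod_cast h
  refine mul_pos two_pos (Real.sin_pos_of_pos_of_lt_pi ?_ ?_)
  · have := Real.pi_pos
    positivity
  · rw [div_lt_iff₀ hp]
    nlinarith [Real.pi_pos]

lemma sin_neg_of_lt {p k : ℕ} (h : p < 2 * (2 * k + 1)) (h2 : 2 * k + 1 < p) :
    0 < -(2 * Real.sin (2 * Real.pi * (2 * k + 1) / p)) := by
  have hp : (0 : ℝ) < p := by exact_mod_cast (by omega : 0 < p)
  have h' : (p : ℝ) < 2 * (2 * k + 1) := by exact_mod_cast h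
  have h2' : 2 * (k : ℝ) + 1 < p := by exact_mod_cast h2
  rw [← mul_neg, ← Real.sin_sub_pi]
  have h3 : 2 * Real.pi * (2 * k + 1) / p - Real.pi = Real.pi * (2 * (2 * k + 1) - p) / p := by
    field_simp
  have h4 : (0 : ℝ) < 2 * (2 * k + 1) - p := by linarith
  refine mul_pos two_pos (Real.sin_pos_of_pos_of_lt_pi ?_ ?_) <;> rw [h3]
  · have := Real.pi_pos
    positivity
  · rw [div_lt_iff₀ hp]
    nlinarith [Real.pi_pos]

lemma neg_one_pow_mul_prod_sin_pos {p m r : ℕ} (hm : p = 2 * m + 1) (hr : r = m / 2) :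
    0 < (-1) ^ r * ∏ k ∈ range m, 2 * Real.sin (2 * Real.pi * (2 * k + 1) / p) := by
  rw [show range m = range (m - r + r) by congr 1; omega, prod_range_add, mul_left_comm]
  refine mul_pos (prod_pos fun k hk => sin_pos_of_lt ?_) ?_
  · have := mem_range.mp hk
    omega
  · nth_rewrite 1 [← card_range r]
    rw [← prod_const, ← prod_mul_distrib]
    refine prod_pos fun k hk => ?_
    have := mem_range.mp hk
    rw [neg_one_mul]
    exact sin_neg_of_lt (by omega) (by omega)

/-- The sign of the quadratic Gauss sum. -/
lemma quadGaussSum_eq_sqrtPStar {p : ℕ} [Fact p.Prime] (hp : p ≠ 2) :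
    quadGaussSum p = sqrtPStar p := by
  have hpodd : p % 2 = 1 := (Fact.out : p.Prime).eq_two_or_odd.resolve_left hp
  obtain ⟨m, hm⟩ : ∃ m, p = 2 * m + 1 := ⟨p / 2, by omega⟩
  rw [quadGaussSum_eq_oddProd hp hm]
  have h1 := oddProd_sq hm
  have h2 := oddProd_eq_sin hm
  have h3 := neg_one_pow_mul_prod_sin_pos hm rfl
  set S : ℝ := ∏ k ∈ range m, 2 * Real.sin (2 * Real.pi * (2 * k + 1) / p) with hS
  have h4 : S ^ 2 = p := by
    have : ((-1 : ℂ) ^ m) * (S : ℂ) ^ 2 = (-1) ^ m * p := by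
      rw [← h1, h2, mul_pow, ← pow_mul, mul_comm m 2, pow_mul, Complex.I_sq]
    have := mul_left_cancel₀ (pow_ne_zero m (neg_ne_zero.mpr one_ne_zero)) this
    exact_mod_cast this
  have h5 : (-1) ^ (m / 2) * S = Real.sqrt p := by
    rw [eq_comm, Real.sqrt_eq_iff_mul_self_eq_of_pos h3, ← h4]
    have : ((-1 : ℝ) ^ (m / 2)) ^ 2 = 1 := by rw [← pow_mul, mul_comm, pow_mul]; simp
    linear_combination S ^ 2 * this
  rw [h2, sqrtPStar, ← h5]
  push_cast
  have h6 : (Complex.I) ^ (2 * (m / 2)) = (-1) ^ (m / 2) := by rw [pow_mul, Complex.I_sq]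
  split_ifs with hp4
  · rw [← h6, show 2 * (m / 2) = m by omega]
  · rw [← h6, ← mul_assoc, ← pow_succ', show 2 * (m / 2) + 1 = m by omega]

lemma eq_of_sum_mul_ep_eq_zero {p : ℕ} [Fact p.Prime] {a : ZMod p → ℤ}
    (h : ∑ j, (a j : ℂ) * ep p j = 0) (i j : ZMod p) : a i = a j := by
  have hζ := isPrimitiveRoot_ep_one p
  set P : ℤ[X] := ∑ k ∈ range p, C (a k) * X ^ k with hP
  have hPζ : aeval (ep p 1) P = 0 := by
    rw [← h, sum_zmod_eq_sum_range, hP, map_sum]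
    exact sum_congr rfl fun k _ => by simp [ep_natCast]
  obtain ⟨R, hR⟩ : cyclotomic p ℤ ∣ P := by
    rw [cyclotomic_eq_minpoly hζ (NeZero.pos p)]
    exact minpoly.isIntegrallyClosed_dvd (hζ.isIntegral (NeZero.pos p)) hPζ
  have hcoeff : ∀ k < p, P.coeff k = a k := fun k hk => by
    simp [hP, finsetSum_coeff, coeff_X_pow, hk]
  have hdeg : P.natDegree ≤ p - 1 := by
    refine natDegree_sum_le_of_forall_le _ _ fun k hk => (natDegree_C_mul_X_pow_le _ _).trans ?_
    have := mem_range.mp hk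
    omega
  have hR0 : R.natDegree = 0 := by
    by_cases hR' : R = 0
    · simp [hR']
    rw [hR, (cyclotomic.monic p ℤ).natDegree_mul' hR', natDegree_cyclotomic,
      Nat.totient_prime Fact.out] at hdeg
    omega
  have key : ∀ j : ZMod p, a j = R.coeff 0 := by
    intro j
    have hj := ZMod.val_lt j
    have := hcoeff j.val hj
    rw [ZMod.natCast_val, ZMod.cast_id] at this
    rw [← this, hR, eq_C_of_natDegree_eq_zero hR0, cyclotomic_prime, coeff_mul_C]
    simp [finsetSum_coeff, coeff_X_pow, hj]
  rw [key i, key j]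

lemma sum_quadraticChar_sub {p : ℕ} [Fact p.Prime] (hp : p ≠ 2) (b : ZMod p) :
    ∑ j : ZMod p, quadraticChar (ZMod p) (j - b) = 0 := by
  rw [← quadraticChar_sum_zero (ringChar_zmod_ne_two hp)]
  exact Fintype.sum_equiv (Equiv.subRight b) _ _ fun _ => rfl

lemma sum_quadraticChar_sq_sub {p : ℕ} [Fact p.Prime] (b : ZMod p) :
    ∑ j : ZMod p, quadraticChar (ZMod p) (j - b) ^ 2 = p - 1 := by
  have h : ∀ j : ZMod p, quadraticChar (ZMod p) (j - b) ^ 2 = 1 - if j = b then 1 else 0 := by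
    intro j
    split_ifs with hj
    · simp [hj]
    · rw [quadraticChar_sq_one (sub_ne_zero.mpr hj), sub_zero]
  simp_rw [h, sum_sub_distrib]
  simp [ZMod.card]

lemma sum_quadraticChar_mul {p : ℕ} [Fact p.Prime] (hp : p ≠ 2) (k l : ZMod p) :
    ∑ j : ZMod p, quadraticChar (ZMod p) (j - k) * quadraticChar (ZMod p) (j - l) =
      (if k = l then (p : ℤ) else 0) - 1 := by
  have hc := ringChar_zmod_ne_two hp
  split_ifs with hkl
  · subst hkl
    simp_rw [← sq]
    exact sum_quadraticChar_sq_sub k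
  have hb : l - k ≠ 0 := sub_ne_zero.mpr (Ne.symm hkl)
  have h1 := jacobiSum_nontrivial_inv (quadraticChar_ne_one hc)
  rw [(quadraticChar_isQuadratic (ZMod p)).inv, jacobiSum] at h1
  have h2 : ∑ j : ZMod p, quadraticChar (ZMod p) (j - k) * quadraticChar (ZMod p) (j - l) =
      ∑ x : ZMod p, quadraticChar (ZMod p) (-1) *
        (quadraticChar (ZMod p) x * quadraticChar (ZMod p) (1 - x)) := by
    refine (Fintype.sum_equiv ((Equiv.mulLeft₀ (l - k) hb).trans (Equiv.addRight k)) _ _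
      fun x => ?_).symm
    simp only [Equiv.trans_apply, Equiv.mulLeft₀_apply, Equiv.coe_addRight, add_sub_cancel_right]
    rw [show (l - k) * x + k - l = (l - k) * (-1 * (1 - x)) by ring, map_mul, map_mul, map_mul]
    linear_combination (-(quadraticChar (ZMod p) x * quadraticChar (ZMod p) (-1) *
      quadraticChar (ZMod p) (1 - x))) * quadraticChar_sq_one hb
  rw [h2, ← mul_sum, h1]
  linear_combination -quadraticChar_sq_one (F := ZMod p) (a := -1) (by simp)

/-- The nonzero nonsquares of `ZMod p`. -/
def nonsquares (p : ℕ) [NeZero p] : Finset (ZMod p) := univ.filter fun j => j ≠ 0 ∧ ¬ IsSquare j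

lemma two_mul_sum_nonsquares {p : ℕ} [Fact p.Prime] (F : ZMod p → ℤ) :
    2 * ∑ j ∈ nonsquares p, F j =
      ∑ j, F j - F 0 - ∑ j, quadraticChar (ZMod p) j * F j := by
  have h : ∀ j : ZMod p, 2 * (if j ≠ 0 ∧ ¬ IsSquare j then F j else 0) =
      F j - (if j = 0 then F j else 0) - quadraticChar (ZMod p) j * F j := by
    intro j
    by_cases h0 : j = 0
    · simp [h0]
    by_cases hs : IsSquare j
    · rw [(quadraticChar_one_iff_isSquare h0).mpr hs]
      simp [hs, h0]
    · rw [quadraticChar_neg_one_iff_not_isSquare.mpr hs]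
      simp [hs, h0]
      ring
  rw [nonsquares, sum_filter, mul_sum]
  simp_rw [h, sum_sub_distrib]
  simp

lemma two_mul_card_nonsquares {p : ℕ} [Fact p.Prime] (hp : p ≠ 2) :
    2 * ((nonsquares p).card : ℤ) = p - 1 := by
  have := two_mul_sum_nonsquares (p := p) fun _ => 1
  simp only [mul_one, quadraticChar_sum_zero (ringChar_zmod_ne_two hp)] at this
  simpa [ZMod.card] using this

lemma two_mul_sum_nonsquares_quadraticChar {p : ℕ} [Fact p.Prime] (hp : p ≠ 2) (b : ZMod p) :
    2 * ∑ j ∈ nonsquares p, quadraticChar (ZMod p) (j - b) =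
      1 - quadraticChar (ZMod p) (-b) - if b = 0 then (p : ℤ) else 0 := by
  have h := sum_quadraticChar_mul hp 0 b
  simp only [sub_zero, eq_comm (a := (0 : ZMod p))] at h
  rw [two_mul_sum_nonsquares, sum_quadraticChar_sub hp, h, zero_sub]
  split_ifs <;> ring_nf

variable {p : ℕ} {F : Type*} [Field F] [Fintype F] [Algebra (ZMod p) F]

/-- The number of solutions `x` of `f x - Tr (β * x) = j`. -/
def shiftCount (p : ℕ) {F : Type*} [Field F] [Fintype F] [Algebra (ZMod p) F]
    (f : F → ZMod p) (β : F) (j : ZMod p) : ℤ :=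
  ∑ x : F, if f x - Algebra.trace (ZMod p) F (β * x) = j then 1 else 0

lemma walsh_eq_sum_shiftCount [Fact p.Prime] (f : F → ZMod p) (β : F) :
    walsh p f β = ∑ j, (shiftCount p f β j : ℂ) * ep p j := by
  simp only [shiftCount, Int.cast_sum, sum_mul]
  rw [sum_comm, walsh]
  exact sum_congr rfl fun x _ => by simp

lemma sum_shiftCount [Fact p.Prime] (f : F → ZMod p) (β : F) :
    ∑ j, shiftCount p f β j = Fintype.card F := by
  simp only [shiftCount]
  rw [sum_comm]
  simp

/-- The values of `shiftCount` are determined by the Walsh transform. -/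
lemma shiftCount_eq_of_walsh_eq [Fact p.Prime] (hp : p ≠ 2) {n : ℕ} (hn : 0 < n)
    (hq : Fintype.card F = p ^ n) {f : F → ZMod p} {β : F} {P : ℤ} {b : ZMod p}
    (h : walsh p f β = P * sqrtPStar p * ep p b) (j : ZMod p) :
    shiftCount p f β j = p ^ (n - 1) + P * quadraticChar (ZMod p) (j - b) := by
  have h1 : sqrtPStar p * ep p b = ∑ j : ZMod p, (quadraticChar (ZMod p) (j - b) : ℂ) * ep p j := by
    rw [← quadGaussSum_eq_sqrtPStar hp, quadGaussSum, sum_mul]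
    refine Fintype.sum_equiv (Equiv.addRight b) _ _ fun j => ?_
    simp [eta0, ep_eq_stdAddChar, AddChar.map_add_eq_mul, mul_assoc]
  have h2 := eq_of_sum_mul_ep_eq_zero
    (a := fun j => shiftCount p f β j - P * quadraticChar (ZMod p) (j - b)) (by
      push_cast
      simp_rw [sub_mul, sum_sub_distrib, ← walsh_eq_sum_shiftCount, mul_assoc, ← mul_sum, ← h1]
      rw [h]
      ring)
  have h3 : ∑ i : ZMod p, (shiftCount p f β i - P * quadraticChar (ZMod p) (i - b)) =
      p * (shiftCount p f β j - P * quadraticChar (ZMod p) (j - b)) := by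
    rw [sum_congr rfl fun i _ => h2 i j, sum_const, card_univ, ZMod.card, nsmul_eq_mul]
  have h4 : (p : ℤ) ^ n = p ^ (n - 1) * p := by rw [← pow_succ, Nat.sub_add_cancel hn]
  rw [sum_sub_distrib, sum_shiftCount, ← mul_sum, sum_quadraticChar_sub hp, hq, Nat.cast_pow,
    h4] at h3
  have hp0 : (p : ℤ) ≠ 0 := Nat.cast_ne_zero.mpr (NeZero.ne p)
  refine mul_left_cancel₀ hp0 ?_
  linear_combination -h3

lemma card_trace_mul_eq [Fact p.Prime] {n : ℕ} (hn : 0 < n) (hq : Fintype.card F = p ^ n)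
    {x : F} (hx : x ≠ 0) (c : ZMod p) :
    ∑ β : F, (if Algebra.trace (ZMod p) F (β * x) = c then (1 : ℤ) else 0) = p ^ (n - 1) := by
  set T : F →+ ZMod p :=
    (Algebra.trace (ZMod p) F).toAddMonoidHom.comp (AddMonoidHom.mulRight x) with hT
  have hsurj : Function.Surjective T := by
    intro c
    obtain ⟨y, hy⟩ := Algebra.trace_surjective (ZMod p) F c
    exact ⟨y * x⁻¹, by simp [hT, hx, hy]⟩
  have h1 : ∀ c d : ZMod p, ∑ β : F, (if T β = c then (1 : ℤ) else 0) =
      ∑ β : F, (if T β = d then (1 : ℤ) else 0) := by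
    intro c d
    obtain ⟨y, hy⟩ := hsurj (d - c)
    refine Fintype.sum_equiv (Equiv.addRight y) _ _ fun β => ?_
    simp only [Equiv.coe_addRight, map_add, hy]
    have h : T β = c ↔ T β + (d - c) = d := by
      rw [← add_sub_assoc, sub_eq_iff_eq_add, add_comm d, add_left_inj]
    simp only [h]
  have h2 : ∑ d : ZMod p, ∑ β : F, (if T β = d then (1 : ℤ) else 0) = (p : ℤ) ^ n := by
    rw [sum_comm]
    simp [hq]
  rw [sum_congr rfl fun d _ => h1 d c] at h2
  have hp0 : (p : ℤ) ≠ 0 := Nat.cast_ne_zero.mpr (NeZero.ne p)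
  refine mul_left_cancel₀ hp0 ?_
  rw [← pow_succ', Nat.sub_add_cancel hn, ← h2]
  simp [ZMod.card, hT]

lemma trace_algebraMap_mul {K : Type*} [Field K] [Algebra (ZMod p) K] [Fact p.Prime] (z : ZMod p)
    (y : K) :
    Algebra.trace (ZMod p) K (algebraMap (ZMod p) K z * y) = z * Algebra.trace (ZMod p) K y := by
  rw [← Algebra.smul_def, map_smul, smul_eq_mul]

/-- Summing `shiftCount` over the multiples of `β` isolates the solutions on the hyperplane
`Tr (β * x) = 0`. -/
lemma sum_shiftCount_algebraMap_mul [Fact p.Prime] {n : ℕ} (hn : 0 < n)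
    (hq : Fintype.card F = p ^ n) (f : F → ZMod p) {β : F} (hβ : β ≠ 0) (j : ZMod p) :
    ∑ z : ZMod p, shiftCount p f (algebraMap (ZMod p) F z * β) j =
      p * (∑ x : F, if f x = j ∧ Algebra.trace (ZMod p) F (β * x) = 0 then 1 else 0) +
        (p ^ n - p ^ (n - 1)) := by
  have h1 : ∀ x : F, (∑ z : ZMod p,
      if f x - Algebra.trace (ZMod p) F (algebraMap (ZMod p) F z * β * x) = j then (1 : ℤ) else 0) =
      p * (if f x = j ∧ Algebra.trace (ZMod p) F (β * x) = 0 then 1 else 0) +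
        (1 - if Algebra.trace (ZMod p) F (x * β) = 0 then 1 else 0) := by
    intro x
    rw [mul_comm x β]
    simp_rw [mul_assoc, trace_algebraMap_mul]
    by_cases hT : Algebra.trace (ZMod p) F (β * x) = 0
    · by_cases hj : f x = j <;> simp [hT, hj, ZMod.card]
    · have h2 : ∀ z : ZMod p, f x - z * Algebra.trace (ZMod p) F (β * x) = j ↔
          z = (f x - j) / Algebra.trace (ZMod p) F (β * x) := by
        intro z
        rw [eq_div_iff hT]
        constructor <;> intro h <;> linear_combination -h
      simp [h2, hT]
  simp only [shiftCount]
  rw [sum_comm, sum_congr rfl fun x _ => h1 x, sum_add_distrib, sum_sub_distrib, ← mul_sum,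
    card_trace_mul_eq hn hq hβ]
  simp [hq]

lemma shiftCount_algebraMap_mul [Fact p.Prime] {f : F → ZMod p} {h : ℕ} (hh : 0 < h)
    (hf : ∀ (a : (ZMod p)ˣ) (x : F),
      f (algebraMap (ZMod p) F (a : ZMod p) * x) = (a : ZMod p) ^ h * f x)
    {z : ZMod p} {a : (ZMod p)ˣ} (hz : z * (a : ZMod p) ^ (h - 1) = 1) (β : F) (j : ZMod p) :
    shiftCount p f (algebraMap (ZMod p) F z * β) j = shiftCount p f β ((a : ZMod p) ^ h * j) := by
  have ha : algebraMap (ZMod p) F (a : ZMod p) ≠ 0 := by simp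
  refine Fintype.sum_equiv (Equiv.mulLeft₀ _ ha) _ _ fun x => ?_
  have h1 : f (algebraMap (ZMod p) F (a : ZMod p) * x) -
      Algebra.trace (ZMod p) F (β * (algebraMap (ZMod p) F (a : ZMod p) * x)) =
      (a : ZMod p) ^ h *
        (f x - Algebra.trace (ZMod p) F (algebraMap (ZMod p) F z * β * x)) := by
    rw [hf, mul_left_comm β, trace_algebraMap_mul, mul_assoc, trace_algebraMap_mul]
    have : (a : ZMod p) ^ h = a ^ (h - 1) * a := by rw [← pow_succ, Nat.sub_add_cancel hh]
    rw [this]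
    linear_combination ((a : ZMod p) * Algebra.trace (ZMod p) F (β * x)) * hz
  simp only [Equiv.mulLeft₀_apply, h1]
  simp

/-- The number of `x` for which `f x - Tr (β * x)` is a nonzero nonsquare. -/
def nsqShiftCount (p : ℕ) [NeZero p] {F : Type*} [Field F] [Fintype F] [Algebra (ZMod p) F]
    (f : F → ZMod p) (β : F) : ℤ :=
  ∑ j ∈ nonsquares p, shiftCount p f β j

lemma nsqShiftCount_algebraMap_mul [Fact p.Prime] {f : F → ZMod p} {h : ℕ} (hh : 0 < h)
    (heven : Even h) (hgcd : Nat.gcd (h - 1) (p - 1) = 1)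
    (hf : ∀ (a : (ZMod p)ˣ) (x : F),
      f (algebraMap (ZMod p) F (a : ZMod p) * x) = (a : ZMod p) ^ h * f x)
    {z : ZMod p} (hz : z ≠ 0) (β : F) :
    nsqShiftCount p f (algebraMap (ZMod p) F z * β) = nsqShiftCount p f β := by
  have hcop : (Nat.card (ZMod p)ˣ).Coprime (h - 1) := by
    rw [Nat.card_eq_fintype_card, ZMod.card_units, Nat.coprime_comm]
    exact hgcd
  obtain ⟨a, ha⟩ := (powCoprime hcop).surjective (Units.mk0 z hz)⁻¹
  have ha' : z * (a : ZMod p) ^ (h - 1) = 1 := by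
    have h1 : a ^ (h - 1) = (Units.mk0 z hz)⁻¹ := ha
    rw [← Units.val_pow_eq_pow_val, h1]
    simp [hz]
  obtain ⟨r, hr⟩ := heven
  have hsq : ∀ j : ZMod p, IsSquare ((a : ZMod p) ^ h * j) ↔ IsSquare j := by
    intro j
    have ha0 : (a : ZMod p) ^ r ≠ 0 := pow_ne_zero _ a.ne_zero
    constructor
    · rintro ⟨y, hy⟩
      refine ⟨y / (a : ZMod p) ^ r, ?_⟩
      rw [div_mul_div_comm, ← hy, hr, pow_add]
      field_simp
    · rintro ⟨y, rfl⟩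
      exact ⟨(a : ZMod p) ^ r * y, by rw [hr, pow_add]; ring⟩
  have ha0 : (a : ZMod p) ^ h ≠ 0 := pow_ne_zero _ a.ne_zero
  refine sum_equiv (Equiv.mulLeft₀ _ ha0) (fun j => ?_) fun j _ => ?_
  · simp [nonsquares, hsq]
  · exact shiftCount_algebraMap_mul hh hf ha' β j

lemma sum_filter_eq_sum_sum {G : Type*} [Fintype G] [Fact p.Prime] (u : G → ZMod p)
    (Q : G → Prop) [DecidablePred Q] :
    ∑ j ∈ nonsquares p, ∑ x : G, (if u x = j ∧ Q x then (1 : ℤ) else 0) =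
      ((univ.filter fun x => (u x ≠ 0 ∧ ¬ IsSquare (u x)) ∧ Q x).card : ℤ) := by
  rw [sum_comm, card_filter, Nat.cast_sum]
  refine sum_congr rfl fun x _ => ?_
  by_cases hQ : Q x <;> simp [hQ, nonsquares]

lemma card_Dnsq [Fact p.Prime] (f : F → ZMod p) :
    ((Dnsq p f).card : ℤ) = nsqShiftCount p f 0 := by
  have := sum_filter_eq_sum_sum f fun _ => True
  simp only [and_true] at this
  simp only [nsqShiftCount, shiftCount, zero_mul, map_zero, sub_zero, this, Dnsq]
  congr

/-- The weight of a codeword of `C_D`, `D = D_{f,nsq}`, through counts of shifts. -/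
lemma mul_wtOn_Dnsq [Fact p.Prime] {n : ℕ} (hn : 0 < n) (hq : Fintype.card F = p ^ n)
    {f : F → ZMod p} {h : ℕ} (hh : 0 < h) (heven : Even h) (hgcd : Nat.gcd (h - 1) (p - 1) = 1)
    (hf : ∀ (a : (ZMod p)ˣ) (x : F),
      f (algebraMap (ZMod p) F (a : ZMod p) * x) = (a : ZMod p) ^ h * f x)
    {β : F} (hβ : β ≠ 0) :
    (p : ℤ) * wtOn p (Dnsq p f) β = (p - 1) * (nsqShiftCount p f 0 - nsqShiftCount p f β) +
      (nonsquares p).card * (p ^ n - p ^ (n - 1)) := by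
  have h1 : ∑ z : ZMod p, nsqShiftCount p f (algebraMap (ZMod p) F z * β) =
      nsqShiftCount p f 0 + (p - 1) * nsqShiftCount p f β := by
    have h2 : ∀ z : ZMod p, nsqShiftCount p f (algebraMap (ZMod p) F z * β) =
        nsqShiftCount p f β +
          if z = 0 then nsqShiftCount p f 0 - nsqShiftCount p f β else 0 := by
      intro z
      split_ifs with hz
      · simp [hz]
      · rw [nsqShiftCount_algebraMap_mul hh heven hgcd hf hz, add_zero]
    simp_rw [h2, sum_add_distrib]
    simp [ZMod.card]
    ring
  have h3 := congrArg (Nat.cast (R := ℤ)) (card_filter_add_card_filter_not (s := Dnsq p f)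
    fun d => Algebra.trace (ZMod p) F (β * d) = 0)
  rw [Nat.cast_add, card_Dnsq] at h3
  have h4 : ∑ z : ZMod p, nsqShiftCount p f (algebraMap (ZMod p) F z * β) =
      p * ((Dnsq p f).filter fun d => Algebra.trace (ZMod p) F (β * d) = 0).card +
        (nonsquares p).card * (p ^ n - p ^ (n - 1)) := by
    simp only [nsqShiftCount]
    rw [sum_comm, sum_congr rfl fun j _ => sum_shiftCount_algebraMap_mul hn hq f hβ j,
      sum_add_distrib, ← mul_sum, sum_filter_eq_sum_sum f fun x =>
        Algebra.trace (ZMod p) F (β * x) = 0, Dnsq, filter_filter, sum_const, nsmul_eq_mul]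
    congr!
  simp only [wtOn, ne_eq]
  linear_combination p * h3 + h4 - h1

lemma sqrtPStar_pow_odd [Fact p.Prime] (hp : p ≠ 2) (t : ℕ) :
    sqrtPStar p ^ (2 * t + 1) = eta0 p (-1) ^ t * p ^ t * sqrtPStar p := by
  have hpodd : p % 2 = 1 := (Fact.out : p.Prime).eq_two_or_odd.resolve_left hp
  obtain ⟨m, hm⟩ : ∃ m, p = 2 * m + 1 := ⟨p / 2, by omega⟩
  rw [pow_succ, pow_mul, eta0_neg_one hp hm, ← mul_pow, ← quadGaussSum_sq hp hm,
    quadGaussSum_eq_sqrtPStar hp]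

/-- The value distribution of all shifts of a weakly regular plateaued function, `n + s` odd. -/
lemma IsWeaklyRegularPlateaued.shiftCount_eq [Fact p.Prime] (hp : p ≠ 2) {n s t : ℕ} (hn : 0 < n)
    (hq : Fintype.card F = p ^ n) {f g : F → ZMod p} {ε : ℂ}
    (hf : IsWeaklyRegularPlateaued p n s f ε g) (ht : n + s = 2 * t + 1) :
    ∃ e : ℤ, (e = 1 ∨ e = -1) ∧ ε * eta0 p (-1) ^ t = e ∧ ∀ β j, shiftCount p f β j =
      p ^ (n - 1) + e * p ^ t *
        (if walsh p f β ≠ 0 then quadraticChar (ZMod p) (j - g β) else 0) := by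
  obtain ⟨hε, hW, -⟩ := hf
  have hpm : ∀ x y : ℤ, (x = 1 ∨ x = -1) → (y = 1 ∨ y = -1) → x * y = 1 ∨ x * y = -1 := by
    rintro x y (rfl | rfl) (rfl | rfl) <;> simp
  have hη : quadraticChar (ZMod p) (-1) ^ t = 1 ∨ quadraticChar (ZMod p) (-1) ^ t = -1 := by
    rcases quadraticChar_dichotomy (F := ZMod p) (a := -1) (by simp) with h | h
    · simp [h]
    · rw [h]
      exact neg_one_pow_eq_or ℤ t
  obtain ⟨e₀, he₀, rfl⟩ : ∃ e₀ : ℤ, (e₀ = 1 ∨ e₀ = -1) ∧ ε = e₀ := by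
    rcases hε with rfl | rfl
    · exact ⟨1, by simp⟩
    · exact ⟨-1, by simp⟩
  refine ⟨e₀ * quadraticChar (ZMod p) (-1) ^ t, hpm _ _ he₀ hη, by simp [eta0], fun β j => ?_⟩
  split_ifs with hβ
  · refine shiftCount_eq_of_walsh_eq hp hn hq ?_ j
    rw [hW β hβ, ht, sqrtPStar_pow_odd hp]
    push_cast [eta0]
    ring
  · have := shiftCount_eq_of_walsh_eq hp hn hq (f := f) (β := β) (P := 0) (b := 0)
      (by simpa using hβ) j
    simpa using this

lemma even_shiftCount_zero {f : F → ZMod p} [Fact p.Prime] (hp : p ≠ 2) (hf0 : f 0 = 0)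
    (hneg : ∀ x, f (-x) = f x) {j : ZMod p} (hj : j ≠ 0) : Even (shiftCount p f 0 j) := by
  rw [← ZMod.intCast_eq_zero_iff_even, shiftCount]
  push_cast
  have hF : (2 : F) ≠ 0 := by
    intro h
    refine Ring.two_ne_zero (R := ZMod p) (ringChar_zmod_ne_two hp) ?_
    refine (algebraMap (ZMod p) F).injective ?_
    rw [map_ofNat, h, map_zero]
  refine sum_involution (fun x _ => -x) (fun x _ => ?_) (fun x _ hx hx' => hx ?_)
    (fun _ _ => mem_univ _) fun x _ => neg_neg x
  · simp only [zero_mul, map_zero, sub_zero, hneg]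
    exact CharTwo.add_self_eq_zero _
  · have hx0 : x = 0 := by
      have : 2 * x = 0 := by linear_combination -hx'
      exact (mul_eq_zero.mp this).resolve_left hF
    simp [hx0, hf0, hj.symm]

lemma sum_shiftCount_dual [Fact p.Prime] {n : ℕ} (hn : 0 < n) (hq : Fintype.card F = p ^ n)
    {f : F → ZMod p} (hf0 : f 0 = 0) (j : ZMod p) :
    ∑ β : F, shiftCount p f β j =
      (p : ℤ) ^ n * (if j = 0 then 1 else 0) + (p ^ n - 1) * p ^ (n - 1) := by
  have h : ∀ x : F, ∑ β : F,
      (if f x - Algebra.trace (ZMod p) F (β * x) = j then (1 : ℤ) else 0) =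
      p ^ (n - 1) +
        if x = 0 then (p : ℤ) ^ n * (if j = 0 then 1 else 0) - p ^ (n - 1) else 0 := by
    intro x
    split_ifs with hx hj
    · simp [hx, hf0, hj, hq]
    · simp [hx, hf0, Ne.symm hj]
    · rw [← card_trace_mul_eq hn hq hx (f x - j), add_zero]
      refine sum_congr rfl fun β _ => ?_
      congr 1
      exact propext ⟨fun h => by linear_combination -h, fun h => by linear_combination -h⟩
  simp only [shiftCount]
  rw [sum_comm, sum_congr rfl fun x _ => h x, sum_add_distrib]
  simp [hq]
  ring

lemma sum_shiftCount_sq [Fact p.Prime] {n : ℕ} (hn : 0 < n) (hq : Fintype.card F = p ^ n)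
    (f : F → ZMod p) :
    ∑ β : F, ∑ j, shiftCount p f β j ^ 2 =
      (p : ℤ) ^ n * p ^ n + (p ^ n * p ^ n - p ^ n) * p ^ (n - 1) := by
  have h1 : ∀ β, ∑ j, shiftCount p f β j ^ 2 = ∑ x : F, ∑ y : F,
      if Algebra.trace (ZMod p) F (β * (x - y)) = f x - f y then (1 : ℤ) else 0 := by
    intro β
    simp only [shiftCount, sq, sum_mul_sum]
    rw [sum_comm]
    refine sum_congr rfl fun x _ => ?_
    rw [sum_comm]
    refine sum_congr rfl fun y _ => ?_
    have h2 : (Algebra.trace (ZMod p) F (β * (x - y)) = f x - f y) ↔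
        f x - Algebra.trace (ZMod p) F (β * x) = f y - Algebra.trace (ZMod p) F (β * y) := by
      rw [mul_sub, map_sub]
      constructor <;> intro h <;> linear_combination -h
    simp [h2]
  have h3 : ∀ x y : F, ∑ β : F,
      (if Algebra.trace (ZMod p) F (β * (x - y)) = f x - f y then (1 : ℤ) else 0) =
      p ^ (n - 1) + if x = y then (p : ℤ) ^ n - p ^ (n - 1) else 0 := by
    intro x y
    split_ifs with hxy
    · simp [hxy, hq]
    · rw [card_trace_mul_eq hn hq (sub_ne_zero.mpr hxy), add_zero]
  rw [sum_congr rfl fun β _ => h1 β, sum_comm, sum_congr rfl fun x _ => sum_comm]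
  rw [sum_congr rfl fun x _ => sum_congr rfl fun y _ => h3 x y]
  simp only [sum_add_distrib, sum_ite_eq, mem_univ, if_true, sum_const, card_univ, hq,
    nsmul_eq_mul, Nat.cast_pow]
  ring

lemma sq_mul_card_support [Fact p.Prime] (hp : p ≠ 2) {n : ℕ} (hn : 0 < n)
    (hq : Fintype.card F = p ^ n) {f g : F → ZMod p} {P : ℤ} {Q : F → Prop}
    (hS : ∀ β j, shiftCount p f β j =
      p ^ (n - 1) + P * (if Q β then quadraticChar (ZMod p) (j - g β) else 0)) :
    P ^ 2 * (univ.filter Q).card = p ^ (2 * n - 1) := by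
  have h1 := sum_shiftCount_sq hn hq f
  have h2 : ∀ β, ∑ j, shiftCount p f β j ^ 2 =
      p * (p ^ (n - 1)) ^ 2 + if Q β then P ^ 2 * (p - 1) else 0 := by
    intro β
    simp_rw [hS]
    split_ifs with hβ
    · simp_rw [add_sq, sum_add_distrib, mul_pow, ← mul_sum, sum_quadraticChar_sq_sub,
        sum_quadraticChar_sub hp]
      simp [ZMod.card]
    · simp [ZMod.card]
  rw [sum_congr rfl fun β _ => h2 β, sum_add_distrib, ← sum_filter] at h1
  simp only [sum_const, card_univ, hq, nsmul_eq_mul, Nat.cast_pow] at h1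
  have hp1 : (p : ℤ) - 1 ≠ 0 := by
    have := (Fact.out : p.Prime).one_lt
    omega
  refine mul_left_cancel₀ hp1 ?_
  obtain ⟨k, rfl⟩ : ∃ k, n = k + 1 := ⟨n - 1, by omega⟩
  rw [show 2 * (k + 1) - 1 = k + k + 1 by omega]
  rw [Nat.add_sub_cancel] at h1
  simp only [pow_succ, pow_add] at h1 ⊢
  linear_combination h1

lemma mul_card_fiber_sub_card_support [Fact p.Prime] (hp : p ≠ 2) {n : ℕ} (hn : 0 < n)
    (hq : Fintype.card F = p ^ n) {f g : F → ZMod p} (hf0 : f 0 = 0) {P : ℤ} {Q : F → Prop}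
    (hS : ∀ β j, shiftCount p f β j =
      p ^ (n - 1) + P * (if Q β then quadraticChar (ZMod p) (j - g β) else 0)) (l : ZMod p) :
    P * (p * (univ.filter fun β => Q β ∧ g β = l).card - (univ.filter Q).card) =
      p ^ n * quadraticChar (ZMod p) (-l) := by
  have h1 : ∑ j : ZMod p, ∑ β : F, quadraticChar (ZMod p) (j - l) * shiftCount p f β j =
      p ^ n * quadraticChar (ZMod p) (-l) := by
    simp_rw [← mul_sum, sum_shiftCount_dual hn hq hf0, mul_add, sum_add_distrib, ← sum_mul,
      sum_quadraticChar_sub hp, zero_mul, add_zero]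
    simp [mul_comm]
  have h2 : ∀ β : F, ∑ j : ZMod p, quadraticChar (ZMod p) (j - l) * shiftCount p f β j =
      P * (p * (if Q β ∧ g β = l then 1 else 0) - if Q β then 1 else 0) := by
    intro β
    simp_rw [hS, mul_add, sum_add_distrib, ← sum_mul, sum_quadraticChar_sub hp]
    by_cases hβ : Q β
    · simp only [hβ, if_true, true_and, mul_left_comm _ P, ← mul_sum, sum_quadraticChar_mul hp,
        eq_comm (a := l)]
      split_ifs <;> ring
    · simp [hβ]
  rw [sum_comm, sum_congr rfl fun β _ => h2 β, ← mul_sum, sum_sub_distrib, ← mul_sum] at h1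
  rw [← h1]
  simp

lemma nsqShiftCount_eq [Fact p.Prime] {n : ℕ} {f g : F → ZMod p} {P : ℤ} {Q : F → Prop}
    (hS : ∀ β j, shiftCount p f β j =
      p ^ (n - 1) + P * (if Q β then quadraticChar (ZMod p) (j - g β) else 0)) (β : F) :
    nsqShiftCount p f β = (nonsquares p).card * p ^ (n - 1) +
      P * (if Q β then ∑ j ∈ nonsquares p, quadraticChar (ZMod p) (j - g β) else 0) := by
  simp_rw [nsqShiftCount, hS, sum_add_distrib, ← mul_sum]
  split_ifs <;> simp

lemma cword_sub_algebraMap_mul [Fact p.Prime] (D : Finset F) (β β' : F) (a : ZMod p) :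
    cword p D (β' - algebraMap (ZMod p) F a * β) = cword p D β' - a • cword p D β := by
  funext d
  simp [cword, sub_mul, mul_assoc, trace_algebraMap_mul]

lemma cword_zero (D : Finset F) : cword p D 0 = 0 := by
  funext d
  simp [cword]

lemma cword_ne_zero_of_wtOn_pos {D : Finset F} {β : F} (h : 0 < wtOn p D β) :
    cword p D β ≠ 0 := by
  obtain ⟨d, hd⟩ := card_pos.mp h
  rw [mem_filter] at hd
  exact fun h0 => hd.2 (congrFun h0 ⟨d, hd.1⟩)

lemma cword_injective_of_wtOn_pos [Fact p.Prime] {D : Finset F}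
    (h : ∀ β : F, β ≠ 0 → 0 < wtOn p D β) : Function.Injective (cword p D) := by
  intro β β' hββ'
  by_contra hne
  refine cword_ne_zero_of_wtOn_pos (h (β - β') (sub_ne_zero.mpr hne)) ?_
  simpa [hββ'] using cword_sub_algebraMap_mul D β' β (1 : ZMod p)

lemma sum_wtOn_of_covers [Fact p.Prime] {D : Finset F} {β β' : F}
    (h : Covers (cword p D β) (cword p D β')) :
    ∑ a : ZMod p, (wtOn p D (β' - algebraMap (ZMod p) F a * β) : ℤ) = (p - 1) * wtOn p D β := by
  simp only [wtOn, card_filter, Nat.cast_sum]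
  rw [sum_comm, mul_sum]
  refine sum_congr rfl fun d hd => ?_
  simp only [sub_mul, map_sub, mul_assoc, trace_algebraMap_mul]
  by_cases hT : Algebra.trace (ZMod p) F (β * d) = 0
  · have hT' : Algebra.trace (ZMod p) F (β' * d) = 0 := by
      by_contra hne
      exact h ⟨d, hd⟩ hne hT
    simp [hT, hT']
  · have h2 : ∀ a : ZMod p, ((if Algebra.trace (ZMod p) F (β' * d) -
        a * Algebra.trace (ZMod p) F (β * d) ≠ 0 then 1 else 0 : ℕ) : ℤ) =
        1 - if a = Algebra.trace (ZMod p) F (β' * d) / Algebra.trace (ZMod p) F (β * d)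
          then 1 else 0 := by
      intro a
      have h3 : a = Algebra.trace (ZMod p) F (β' * d) / Algebra.trace (ZMod p) F (β * d) ↔
          Algebra.trace (ZMod p) F (β' * d) - a * Algebra.trace (ZMod p) F (β * d) = 0 := by
        rw [eq_div_iff hT, sub_eq_zero, eq_comm]
      simp only [h3]
      split_ifs <;> simp_all
    simp_rw [h2, sum_sub_distrib]
    simp [hT, ZMod.card]

/-- The Ashikhmin–Barg criterion for minimality. -/
lemma isMinimalCode_of_wtOn_bounds [Fact p.Prime] {D : Finset F} {lo hi : ℤ}
    (hlo : ∀ β : F, β ≠ 0 → lo ≤ wtOn p D β) (hhi : ∀ β : F, β ≠ 0 → wtOn p D β ≤ hi)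
    (h : (p - 1) * hi < p * lo) : IsMinimalCode p D := by
  intro β hβ β' hβ' hcov
  by_cases hex : ∃ a : ZMod p, β' - algebraMap (ZMod p) F a * β = 0
  · obtain ⟨a, ha⟩ := hex
    have h1 := cword_sub_algebraMap_mul D β β' a
    rw [ha, cword_zero] at h1
    have h2 := (sub_eq_zero.mp h1.symm)
    refine ⟨a, ?_, h2⟩
    rintro rfl
    exact hβ' (by rw [h2, zero_smul])
  · push Not at hex
    exfalso
    have h1 : (p : ℤ) * lo ≤ (p - 1) * wtOn p D β := by
      rw [← sum_wtOn_of_covers hcov]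
      have := card_nsmul_le_sum (univ : Finset (ZMod p)) _ lo fun a _ => hlo _ (hex a)
      simpa [ZMod.card] using this
    have h2 : ((p : ℤ) - 1) * wtOn p D β ≤ (p - 1) * hi := by
      refine mul_le_mul_of_nonneg_left (hhi β ?_) ?_
      · rintro rfl
        exact hβ (cword_zero D)
      · have := (Fact.out : p.Prime).one_lt
        omega
    omega

/-- Minimality and parameters of `C_D` from sharp weight bounds. -/
lemma isMinimalCode_and_hasParams [Fact p.Prime] {D : Finset F} {m lo hi : ℤ} (hD : D.card = m)
    (hlo : ∀ β : F, β ≠ 0 → lo ≤ wtOn p D β) (hhi : ∀ β : F, β ≠ 0 → wtOn p D β ≤ hi)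
    (h : (p - 1) * hi < p * lo) (hpos : 0 < lo) (hex : ∃ β : F, (wtOn p D β : ℤ) = lo) :
    IsMinimalCode p D ∧ HasParams p D m lo := by
  refine ⟨isMinimalCode_of_wtOn_bounds hlo hhi h, hD, ?_, fun β hβ => hlo β ?_, ?_⟩
  · refine cword_injective_of_wtOn_pos fun β hβ => ?_
    have := hlo β hβ
    omega
  · rintro rfl
    exact hβ (cword_zero D)
  · obtain ⟨β, hβ⟩ := hex
    exact ⟨β, cword_ne_zero_of_wtOn_pos (by omega), hβ⟩

lemma wtOn_Dnsq_eq [Fact p.Prime] (hp : p ≠ 2) {n : ℕ} (hn : 2 ≤ n)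
    (hq : Fintype.card F = p ^ n) {f g : F → ZMod p} {h : ℕ} (hh : 0 < h) (heven : Even h)
    (hgcd : Nat.gcd (h - 1) (p - 1) = 1)
    (hf : ∀ (a : (ZMod p)ˣ) (x : F),
      f (algebraMap (ZMod p) F (a : ZMod p) * x) = (a : ZMod p) ^ h * f x)
    {R : ℤ} {Q : F → Prop} (hQ0 : Q 0) (hg0 : g 0 = 0)
    (hS : ∀ β j, shiftCount p f β j =
      p ^ (n - 1) + p * R * (if Q β then quadraticChar (ZMod p) (j - g β) else 0))
    {β : F} (hβ : β ≠ 0) :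
    (wtOn p (Dnsq p f) β : ℤ) = (nonsquares p).card * ((p - 1) * p ^ (n - 2) - R *
      (p - 1 + if Q β then
        1 - quadraticChar (ZMod p) (-g β) - (if g β = 0 then (p : ℤ) else 0) else 0)) := by
  have h1 := mul_wtOn_Dnsq (by omega) hq hh heven hgcd hf hβ
  have hK := two_mul_card_nonsquares hp
  have h2 := two_mul_sum_nonsquares_quadraticChar hp (g β)
  have h3 := two_mul_sum_nonsquares_quadraticChar hp 0
  rw [nsqShiftCount_eq hS, nsqShiftCount_eq hS, if_pos hQ0, hg0] at h1
  rw [← h2, ← hK]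
  rw [neg_zero, quadraticChar_zero, if_pos rfl] at h3
  have hp0 : (p : ℤ) ≠ 0 := Nat.cast_ne_zero.mpr (NeZero.ne p)
  refine mul_left_cancel₀ hp0 ?_
  obtain ⟨k, rfl⟩ : ∃ k, n = k + 2 := ⟨n - 2, by omega⟩
  rw [h1]
  simp only [Nat.add_sub_cancel, show k + 2 - 1 = k + 1 by omega, pow_succ]
  set K : ℤ := ((nonsquares p).card : ℤ)
  have h4 : ∑ j ∈ nonsquares p, quadraticChar (ZMod p) (j - 0) = -K := by linarith
  rw [h4, ← hK]
  have hpK : (p : ℤ) = 2 * K + 1 := by linarith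
  split_ifs <;> rw [hpK] <;> ring

lemma IsWRP.neg [Fact p.Prime] {n s : ℕ} {f g : F → ZMod p} {ε : ℂ} (hf : IsWRP p n s f ε g)
    (x : F) : f (-x) = f x := by
  obtain ⟨-, -, -, h, -, heven, -, hhom⟩ := hf
  simpa [heven.neg_one_pow] using hhom (-1) x

/-- Bounds for the correction term in `wtOn_Dnsq_eq`. -/
lemma weight_correction_bounds [Fact p.Prime] (q : Prop) (l : ZMod p) :
    0 ≤ (p - 1 + if q then 1 - quadraticChar (ZMod p) (-l) - (if l = 0 then (p : ℤ) else 0)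
      else 0 : ℤ) ∧
    (p - 1 + if q then 1 - quadraticChar (ZMod p) (-l) - (if l = 0 then (p : ℤ) else 0)
      else 0 : ℤ) ≤ p + 1 := by
  have hp1 := (Fact.out : p.Prime).one_lt
  by_cases hq : q
  · by_cases hl : l = 0
    · simp [hq, hl]
      omega
    · rcases quadraticChar_dichotomy (neg_ne_zero.mpr hl) with h | h <;>
        simp only [hq, hl, h, if_true, if_false] <;> omega
  · simp only [hq, if_false]
    omega

lemma exists_quadraticChar_neg_eq_neg_one [Fact p.Prime] (hp : p ≠ 2) :
    ∃ l : ZMod p, quadraticChar (ZMod p) (-l) = -1 := by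
  obtain ⟨a, ha⟩ := quadraticChar_exists_neg_one (ringChar_zmod_ne_two hp)
  exact ⟨-a, by rwa [neg_neg]⟩

end

theorem statement_19 (p n s : ℕ) [Fact p.Prime] (hp : p ≠ 2) (hn : 0 < n) (hs : s ≤ n)
    {F : Type*} [Field F] [Fintype F] [Algebra (ZMod p) F]
    (hq : Fintype.card F = p ^ n)
    (f g : F → ZMod p) (ε : ℂ)
    (hf : IsWRP p n s f ε g)
    (hodd : Odd (n + s)) (hcond : s + 5 ≤ n) :
    (ε * (eta0 p (-1)) ^ ((n + s - 1) / 2) = 1 →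
      IsMinimalCode p (Dnsq p f) ∧
      HasParams p (Dnsq p f)
        (((p : ℤ) - 1) / 2 * ((p : ℤ) ^ (n - 1) - (p : ℤ) ^ ((n + s - 1) / 2)))
        (((p : ℤ) - 1) / 2 * (((p : ℤ) - 1) * (p : ℤ) ^ (n - 2)
            - ((p : ℤ) + 1) * (p : ℤ) ^ ((n + s - 3) / 2)))) ∧
    (ε * (eta0 p (-1)) ^ ((n + s - 1) / 2) ≠ 1 →
      IsMinimalCode p (Dnsq p f) ∧
      HasParams p (Dnsq p f)
        (((p : ℤ) - 1) / 2 * ((p : ℤ) ^ (n - 1) + (p : ℤ) ^ ((n + s - 1) / 2)))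
        (((p : ℤ) - 1) ^ 2 / 2 * (p : ℤ) ^ (n - 2))) := by
  have hneg := hf.neg
  obtain ⟨hwr, hW0, hf0, h, hh, heven, hgcd, hhom⟩ := hf
  obtain ⟨t, ht⟩ := hodd
  obtain ⟨r, rfl⟩ : ∃ r, t = r + 1 := ⟨t - 1, by omega⟩
  rw [show (n + s - 1) / 2 = r + 1 by omega, show (n + s - 3) / 2 = r by omega]
  obtain ⟨e, he, hεe, hS⟩ := hwr.shiftCount_eq hp hn hq ht
  have hK := two_mul_card_nonsquares hp
  have hp3 : (3 : ℤ) ≤ p := by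
    have := (Fact.out : p.Prime).two_le
    omega
  set K : ℤ := ((nonsquares p).card : ℤ) with hKdef
  have hpK : (p : ℤ) = 2 * K + 1 := by linarith
  have hK1 : 1 ≤ K := by omega
  have hg0 : g 0 = 0 := by
    by_contra hne
    have h1 := even_shiftCount_zero hp hf0 hneg hne
    rw [hS, sub_self, quadraticChar_zero, ite_self, mul_zero, add_zero] at h1
    have hpodd : Odd (p : ℤ) := ⟨K, hpK⟩
    exact Int.not_even_iff_odd.mpr (hpodd.pow) h1
  obtain ⟨Q, hQ⟩ : ∃ Q : F → Prop, ∀ β, Q β ↔ walsh p f β ≠ 0 := ⟨_, fun _ => Iff.rfl⟩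
  rw [← hQ] at hW0
  replace hS : ∀ β j, shiftCount p f β j = p ^ (n - 1) + p * (e * p ^ r) *
      (if Q β then quadraticChar (ZMod p) (j - g β) else 0) := by
    intro β j
    simp only [hS, ← hQ]
    ring
  have hdiv1 : ((p : ℤ) - 1) / 2 = K := by omega
  have hdiv2 : ((p : ℤ) - 1) ^ 2 / 2 = K * (p - 1) := by
    rw [hpK, show (2 * K + 1 - 1) ^ 2 = 2 * (K * (2 * K + 1 - 1)) by ring]
    simp
  have hw := fun β hβ => wtOn_Dnsq_eq hp (by omega) hq hh heven hgcd hhom hW0 hg0 hS (β := β) hβ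
  have hD : ((Dnsq p f).card : ℤ) = K * (p ^ (n - 1) - e * p ^ (r + 1)) := by
    have h3 := two_mul_sum_nonsquares_quadraticChar hp 0
    rw [neg_zero, quadraticChar_zero, if_pos rfl] at h3
    rw [card_Dnsq, nsqShiftCount_eq hS, if_pos hW0, hg0,
      show ∑ j ∈ nonsquares p, quadraticChar (ZMod p) (j - 0) = -K by linarith]
    ring
  have hfib := mul_card_fiber_sub_card_support hp hn hq hf0 hS
  have hsupp : ((univ.filter Q).card : ℤ) = p ^ (n - s) := by
    have h1 := sq_mul_card_support hp hn hq hS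
    have he2 : e ^ 2 = 1 := by rcases he with rfl | rfl <;> norm_num
    have hp0 : (p : ℤ) ^ (2 * r + 2) ≠ 0 := by positivity
    refine mul_left_cancel₀ hp0 ?_
    rw [← pow_add, show 2 * r + 2 + (n - s) = 2 * n - 1 by omega, ← h1]
    linear_combination (-(p : ℤ) ^ (2 * r + 2) * (univ.filter Q).card) * he2
  rw [hsupp] at hfib
  have hA : (0 : ℤ) < p ^ r := by positivity
  have hB : (p : ℤ) ^ r * p ^ 2 ≤ p ^ (n - 2) := by
    rw [← pow_add]
    exact pow_le_pow_right₀ (by omega) (by omega)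
  have hb := fun β : F => weight_correction_bounds (p := p) (Q β) (g β)
  obtain ⟨c, hc⟩ : ∃ c : F → ℤ, ∀ β, c β = p - 1 + if Q β then
      1 - quadraticChar (ZMod p) (-g β) - (if g β = 0 then (p : ℤ) else 0) else 0 :=
    ⟨_, fun _ => rfl⟩
  simp only [← hc] at hw hb
  rw [hdiv1, hdiv2]
  generalize (p : ℤ) ^ (n - 2) = q₁ at hw hB ⊢
  rcases he with rfl | rfl
  · refine ⟨fun _ => ?_, fun h1 => absurd (by simpa using hεe) h1⟩
    rw [one_mul] at hD
    simp only [one_mul] at hw hfib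
    have h9 : p * (p + 1) * (p : ℤ) ^ r < (p - 1) * q₁ := by
      nlinarith [mul_pos hA (show (0 : ℤ) < p * (p ^ 2 - 2 * p - 1) by nlinarith)]
    refine isMinimalCode_and_hasParams (hi := K * ((p - 1) * q₁)) hD (fun β hβ => ?_)
      (fun β hβ => ?_) ?_ ?_ ?_
    · rw [hw β hβ]
      refine mul_le_mul_of_nonneg_left ?_ (by omega)
      linarith [mul_le_mul_of_nonneg_left (hb β).2 hA.le]
    · rw [hw β hβ]
      refine mul_le_mul_of_nonneg_left ?_ (by omega)
      linarith [mul_nonneg hA.le (hb β).1]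
    · linarith [mul_lt_mul_of_pos_left h9 hK1]
    · refine mul_pos hK1 ?_
      nlinarith
    · obtain ⟨l, hl⟩ := exists_quadraticChar_neg_eq_neg_one hp
      have hl0 : l ≠ 0 := by
        rintro rfl
        simp at hl
      have h2 := hfib l
      obtain ⟨β, hβ⟩ : (univ.filter fun β => Q β ∧ g β = l).Nonempty := by
        rw [nonempty_iff_ne_empty]
        intro hem
        rw [hem, hl, card_empty, Nat.cast_zero, mul_zero, zero_sub, mul_neg, mul_neg_one,
          neg_inj, ← pow_succ', ← pow_add] at h2
        have := Nat.pow_right_injective (Fact.out : p.Prime).two_le (by exact_mod_cast h2)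
        omega
      rw [mem_filter] at hβ
      have hβ0 : β ≠ 0 := by
        rintro rfl
        exact hl0 (hβ.2.2.symm.trans hg0)
      refine ⟨β, ?_⟩
      rw [hw β hβ0, hc, if_pos hβ.2.1, hβ.2.2, hl, if_neg hl0]
      ring
  · refine ⟨fun h1 => ?_, fun _ => ?_⟩
    · rw [h1] at hεe
      norm_num at hεe
    rw [neg_one_mul, sub_neg_eq_add] at hD
    simp only [neg_mul, one_mul, sub_neg_eq_add] at hw
    have h9 : (p + 1) * (p : ℤ) ^ r < q₁ := by
      nlinarith [mul_pos hA (show (0 : ℤ) < p ^ 2 - p - 1 by nlinarith)]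
    have hq₁ : 0 < q₁ := by nlinarith
    refine isMinimalCode_and_hasParams (hi := K * ((p - 1) * q₁ + p ^ r * (p + 1))) hD
      (fun β hβ => ?_) (fun β hβ => ?_) ?_ ?_ ?_
    · rw [hw β hβ]
      rw [mul_assoc]
      refine mul_le_mul_of_nonneg_left ?_ (by omega)
      linarith [mul_nonneg hA.le (hb β).1]
    · rw [hw β hβ]
      refine mul_le_mul_of_nonneg_left ?_ (by omega)
      linarith [mul_le_mul_of_nonneg_left (hb β).2 hA.le]
    · linarith [mul_lt_mul_of_pos_left h9 (mul_pos hK1 (show (0 : ℤ) < p - 1 by omega))]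
    · exact mul_pos (mul_pos hK1 (by omega)) hq₁
    · have h2 := hfib 0
      rw [neg_zero, quadraticChar_zero, mul_zero, mul_eq_zero] at h2
      have h3 : (p : ℤ) * (univ.filter fun β => Q β ∧ g β = 0).card = p ^ (n - s - 1 + 1) := by
        rw [Nat.sub_add_cancel (by omega)]
        refine sub_eq_zero.mp (h2.resolve_left ?_)
        have : p ≠ 0 := (Fact.out : p.Prime).ne_zero
        simp [this]
      rw [pow_succ'] at h3
      replace h3 := mul_left_cancel₀ (show (p : ℤ) ≠ 0 by omega) h3
      have h4 : 1 < (univ.filter fun β => Q β ∧ g β = 0).card := by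
        rw [show (univ.filter fun β => Q β ∧ g β = 0).card = p ^ (n - s - 1) by exact_mod_cast h3]
        exact Nat.one_lt_pow (by omega) (Fact.out : p.Prime).one_lt
      obtain ⟨β, hβ, hβ0⟩ := exists_mem_ne h4 0
      rw [mem_filter] at hβ
      refine ⟨β, ?_⟩
      rw [hw β hβ0, hc, if_pos hβ.2.1, hβ.2.2, neg_zero, quadraticChar_zero, if_pos rfl]
      ring
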